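/- arXiv:1910.12537 — 4 statements merged into one kernel-verified Lean document; each statement's English description precedes it below -/
import Mathlib

section
/- Let Λ ⊆ ℂ be a lattice and let ℤ[i] = ℤ + ℤ·i be the Gaussian integer lattice. Set M := {ζ ∈ ℂ : ζ·(ℤ + ℤ·i) ⊆ Λ}. If M contains a nonzero element, then there exists a nonzero ψ ∈ ℂ such that M = ℤ·ψ + ℤ·(i·ψ); equivalently, M = ψ·ℤ[i] = {ψ·u : u ∈ ℤ[i]}. -/
/-- A lattice in `ℂ` has finitely many points in every closed ball around the origin. -/
theorem finite_lattice_inter_closedBall {ω₁ ω₂ : ℂ} (h : LinearIndependent ℝ ![ω₁, ω₂]) (R : ℝ) :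
    ({z : ℂ | ∃ a b : ℤ, z = (a : ℂ) * ω₁ + (b : ℂ) * ω₂} ∩ Metric.closedBall 0 R).Finite := by
  let B := basisOfLinearIndependentOfCardEqFinrank h (by simp [Complex.finrank_real_complex])
  refine (ZSpan.setFinite_inter B (Metric.isBounded_closedBall (x := (0 : ℂ)) (r := R))).subset ?_
  rintro z ⟨⟨a, b, rfl⟩, hz⟩
  refine ⟨hz, ?_⟩
  have h₁ : ω₁ ∈ Submodule.span ℤ (Set.range B) := Submodule.subset_span ⟨0, by simp [B]⟩
  have h₂ : ω₂ ∈ Submodule.span ℤ (Set.range B) := Submodule.subset_span ⟨1, by simp [B]⟩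
  simpa only [zsmul_eq_mul, SetLike.mem_coe] using
    add_mem (Submodule.smul_mem _ a h₁) (Submodule.smul_mem _ b h₂)

/-- A nonzero additive subgroup of `ℂ` that is stable under multiplication by `i` and has finitely
many points in every closed ball around the origin is generated by `ψ` and `i * ψ` for some
nonzero `ψ`. -/
theorem AddSubgroup.exists_gaussian_generator (G : AddSubgroup ℂ)
    (hI : ∀ z ∈ G, Complex.I * z ∈ G)
    (hfin : ∀ R : ℝ, ((G : Set ℂ) ∩ Metric.closedBall 0 R).Finite)
    (hne : ∃ ζ ∈ G, ζ ≠ 0) :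
    ∃ ψ : ℂ, ψ ≠ 0 ∧
      (G : Set ℂ) = {z : ℂ | ∃ a b : ℤ, z = (a : ℂ) * ψ + (b : ℂ) * (Complex.I * ψ)} := by
  obtain ⟨ζ, hζ, hζ0⟩ := hne
  obtain ⟨ψ, ⟨⟨hψ, hψζ⟩, hψ0⟩, hmin⟩ :=
    Set.exists_min_image (((G : Set ℂ) ∩ Metric.closedBall 0 ‖ζ‖) \ {0}) norm
      ((hfin ‖ζ‖).subset Set.sdiff_subset) ⟨ζ, ⟨hζ, by simp⟩, hζ0⟩
  have hψ0 : ψ ≠ 0 := hψ0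
  have hcomb (a b : ℤ) : (a : ℂ) * ψ + (b : ℂ) * (Complex.I * ψ) ∈ G := by
    simpa only [zsmul_eq_mul] using add_mem (G.zsmul_mem hψ a) (G.zsmul_mem (hI ψ hψ) b)
  refine ⟨ψ, hψ0, Set.Subset.antisymm (fun z hz => ?_) ?_⟩
  · set w := z / ψ with hw
    refine ⟨round w.re, round w.im, ?_⟩
    set r := z - ((round w.re : ℂ) * ψ + (round w.im : ℂ) * (Complex.I * ψ)) with hr
    have hrG : r ∈ G := sub_mem hz (hcomb _ _)
    have hrw : r = (w - ((round w.re : ℂ) + (round w.im : ℂ) * Complex.I)) * ψ := by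
      have : z = w * ψ := by rw [hw, div_mul_cancel₀ _ hψ0]
      rw [hr]
      linear_combination this
    have hlt : ‖w - ((round w.re : ℂ) + (round w.im : ℂ) * Complex.I)‖ < 1 := by
      rw [← sq_lt_one_iff₀ (norm_nonneg _), Complex.sq_norm, Complex.normSq_apply]
      have h₁ := abs_le.1 (abs_sub_round w.re)
      have h₂ := abs_le.1 (abs_sub_round w.im)
      simp
      nlinarith
    have hrψ : ‖r‖ < ‖ψ‖ := by
      rw [hrw, norm_mul]
      exact mul_lt_of_lt_one_left (norm_pos_iff.2 hψ0) hlt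
    by_contra hne
    refine (hmin r ⟨⟨hrG, ?_⟩, sub_ne_zero.2 hne⟩).not_gt hrψ
    rw [mem_closedBall_zero_iff] at hψζ ⊢
    exact hrψ.le.trans hψζ
  · rintro z ⟨a, b, rfl⟩
    exact hcomb a b

/-- If `Λ ⊆ ℂ` is a lattice and
`M = {ζ : ζ·(ℤ + ℤ·i) ⊆ Λ}` contains a nonzero element, then there is a nonzero
`ψ` with `M = ℤ·ψ + ℤ·(i·ψ)`. -/
theorem hom_lattice_gaussian_generated
    (Λ : Set ℂ)
    (hΛ : ∃ ω₁ ω₂ : ℂ, LinearIndependent ℝ ![ω₁, ω₂] ∧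
      Λ = {z : ℂ | ∃ a b : ℤ, z = (a : ℂ) * ω₁ + (b : ℂ) * ω₂})
    (M : Set ℂ)
    (hM : M = {ζ : ℂ | ∀ u ∈ {z : ℂ | ∃ a b : ℤ, z = (a : ℂ) + (b : ℂ) * Complex.I},
      ζ * u ∈ Λ})
    (hne : ∃ ζ ∈ M, ζ ≠ 0) :
    ∃ ψ : ℂ, ψ ≠ 0 ∧
      M = {z : ℂ | ∃ a b : ℤ, z = (a : ℂ) * ψ + (b : ℂ) * (Complex.I * ψ)} := by
  obtain ⟨ω₁, ω₂, hω, rfl⟩ := hΛ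
  let L : AddSubgroup ℂ :=
    { carrier := {z : ℂ | ∃ a b : ℤ, z = (a : ℂ) * ω₁ + (b : ℂ) * ω₂}
      zero_mem' := ⟨0, 0, by simp⟩
      add_mem' := by
        rintro _ _ ⟨a, b, rfl⟩ ⟨c, d, rfl⟩
        exact ⟨a + c, b + d, by push_cast; ring⟩
      neg_mem' := by
        rintro _ ⟨a, b, rfl⟩
        exact ⟨-a, -b, by push_cast; ring⟩ }
  let G : AddSubgroup ℂ :=
    { carrier := {ζ : ℂ | ∀ u ∈ {z : ℂ | ∃ a b : ℤ, z = (a : ℂ) + (b : ℂ) * Complex.I},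
        ζ * u ∈ L}
      zero_mem' := fun u _ => by simp [L.zero_mem]
      add_mem' := fun hx hy u hu => by simpa only [add_mul] using L.add_mem (hx u hu) (hy u hu)
      neg_mem' := fun hx u hu => by simpa only [neg_mul] using L.neg_mem (hx u hu) }
  have hMG : M = G := hM
  rw [hMG] at hne ⊢
  refine G.exists_gaussian_generator ?_ (fun R => ?_) hne
  · rintro z hz _ ⟨a, b, rfl⟩
    convert hz _ ⟨-b, a, rfl⟩ using 1
    push_cast
    linear_combination (b : ℂ) * z * Complex.I_mul_I
  · refine (finite_lattice_inter_closedBall hω R).subset (Set.inter_subset_inter_left _ ?_)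
    intro z hz
    have hzL : z * 1 ∈ L := hz 1 ⟨1, 0, by simp⟩
    rwa [mul_one] at hzL
end

section
/- Let Λ ⊆ ℂ be a lattice, let ω = e^{2πi/3}, and let ℤ + ℤ·ω be the hexagonal lattice. Set M := {ζ ∈ ℂ : ζ·(ℤ + ℤ·ω) ⊆ Λ}. If M contains a nonzero element, then there exists a nonzero ψ ∈ ℂ such that M = ℤ·ψ + ℤ·(ω·ψ); equivalently, M = ψ·(ℤ + ℤω) = {ψ·u : u ∈ ℤ + ℤω}. -/
namespace EisensteinLattice

variable {ω : ℂ}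

lemma re_and_sq_im (hω : ω = Complex.exp (2 * Real.pi * Complex.I / 3)) :
    ω.re = -1 / 2 ∧ ω.im ^ 2 = 3 / 4 := by
  have h : ω.re = -1 / 2 := by
    have hcos : Real.cos (2 * Real.pi / 3) = -1 / 2 := by
      rw [show 2 * Real.pi / 3 = Real.pi - Real.pi / 3 by ring, Real.cos_pi_sub,
        Real.cos_pi_div_three]
      norm_num
    rw [hω, show (2 * Real.pi * Complex.I / 3 : ℂ) = ((2 * Real.pi / 3 : ℝ) : ℂ) * Complex.I by
      push_cast; ring, Complex.exp_ofReal_mul_I_re, hcos]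
  have hnorm : Complex.normSq ω = 1 := by
    rw [hω, show (2 * Real.pi * Complex.I / 3 : ℂ) = ((2 * Real.pi / 3 : ℝ) : ℂ) * Complex.I by
      push_cast; ring, Complex.normSq_eq_norm_sq, Complex.norm_exp_ofReal_mul_I, one_pow]
  rw [Complex.normSq_apply] at hnorm
  exact ⟨h, by rw [h] at hnorm; linarith⟩

lemma sq_eq (hre : ω.re = -1 / 2) (him : ω.im ^ 2 = 3 / 4) : ω ^ 2 = -1 - ω := by
  apply Complex.ext
  · simp only [pow_two, Complex.mul_re, Complex.sub_re, Complex.neg_re, Complex.one_re, hre]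
    linarith
  · simp only [pow_two, Complex.mul_im, Complex.sub_im, Complex.neg_im, Complex.one_im, hre]
    ring

lemma normSq_add_mul (hre : ω.re = -1 / 2) (him : ω.im ^ 2 = 3 / 4) (x y : ℝ) :
    Complex.normSq (x + y * ω) = x ^ 2 - x * y + y ^ 2 := by
  simp only [Complex.normSq_apply, Complex.add_re, Complex.add_im, Complex.mul_re, Complex.mul_im,
    Complex.ofReal_re, Complex.ofReal_im, hre]
  linear_combination y ^ 2 * him

lemma exists_eq_add_mul (hre : ω.re = -1 / 2) (him : ω.im ^ 2 = 3 / 4) (w : ℂ) :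
    ∃ x y : ℝ, w = x + y * ω := by
  have h0 : ω.im ≠ 0 := by rintro h; norm_num [h] at him
  refine ⟨w.re + w.im / ω.im / 2, w.im / ω.im, Complex.ext ?_ ?_⟩
  · simp only [Complex.add_re, Complex.mul_re, Complex.ofReal_re, Complex.ofReal_im, hre]
    ring
  · simp only [Complex.add_im, Complex.mul_im, Complex.ofReal_re, Complex.ofReal_im]
    field_simp
    ring

/-- The Euclidean property of the Eisenstein integers. -/
lemma exists_normSq_sub_lt_one (hre : ω.re = -1 / 2) (him : ω.im ^ 2 = 3 / 4) (w : ℂ) :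
    ∃ a b : ℤ, Complex.normSq (w - (a + b * ω)) < 1 := by
  obtain ⟨x, y, rfl⟩ := exists_eq_add_mul hre him w
  refine ⟨round x, round y, ?_⟩
  have hx := abs_le.mp (abs_sub_round x)
  have hy := abs_le.mp (abs_sub_round y)
  have h : (x + y * ω - (round x + round y * ω) : ℂ) =
      ((x - round x : ℝ) : ℂ) + ((y - round y : ℝ) : ℂ) * ω := by
    push_cast; ring
  rw [h, normSq_add_mul hre him]
  generalize x - round x = s at *
  generalize y - round y = t at *
  nlinarith [mul_nonneg (sub_nonneg.2 hx.1) (sub_nonneg.2 hx.2),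
    mul_nonneg (sub_nonneg.2 hy.1) (sub_nonneg.2 hy.2),
    mul_nonneg (sub_nonneg.2 hx.1) (sub_nonneg.2 hy.2),
    mul_nonneg (sub_nonneg.2 hy.1) (sub_nonneg.2 hx.2),
    mul_nonneg (sub_nonneg.2 hx.1) (sub_nonneg.2 hy.1),
    mul_nonneg (sub_nonneg.2 hx.2) (sub_nonneg.2 hy.2)]

lemma int_mul_add_mul_mem {M : AddSubgroup ℂ} (hmul : ∀ z ∈ M, ω * z ∈ M) {z : ℂ} (hz : z ∈ M)
    (a b : ℤ) : (a : ℂ) * z + b * (ω * z) ∈ M := by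
  simpa only [zsmul_eq_mul] using
    M.add_mem (M.zsmul_mem hz a) (M.zsmul_mem (hmul z hz) b)

/-- A nonzero `ω`-stable subgroup whose squared norms are natural multiples of a fixed positive
real is generated over `ℤ[ω]` by an element of least norm. -/
lemma exists_generator (hre : ω.re = -1 / 2) (him : ω.im ^ 2 = 3 / 4) {M : AddSubgroup ℂ}
    (hmul : ∀ z ∈ M, ω * z ∈ M) {c : ℝ} (hc : 0 < c)
    (hnorm : ∀ z ∈ M, ∃ n : ℕ, Complex.normSq z = n * c) (hne : ∃ z ∈ M, z ≠ 0) :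
    ∃ ψ : ℂ, ψ ≠ 0 ∧ ∀ z, z ∈ M ↔ ∃ a b : ℤ, z = (a : ℂ) * ψ + b * (ω * ψ) := by
  classical
  have hex : ∃ n : ℕ, ∃ z ∈ M, z ≠ 0 ∧ Complex.normSq z = n * c := by
    obtain ⟨z, hz, h0⟩ := hne
    obtain ⟨n, hn⟩ := hnorm z hz
    exact ⟨n, z, hz, h0, hn⟩
  obtain ⟨ψ, hψ, hψ0, hψn⟩ := Nat.find_spec hex
  refine ⟨ψ, hψ0, fun z => ⟨fun hz => ?_, ?_⟩⟩
  · obtain ⟨a, b, hab⟩ := exists_normSq_sub_lt_one hre him (z / ψ)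
    refine ⟨a, b, ?_⟩
    by_contra hr
    set r := z - (a * ψ + b * (ω * ψ)) with hrdef
    have hrM : r ∈ M := M.sub_mem hz (int_mul_add_mul_mem hmul hψ a b)
    obtain ⟨m, hm⟩ := hnorm r hrM
    have hle := Nat.find_min' hex ⟨r, hrM, sub_ne_zero.2 hr, hm⟩
    have hrψ : r = (z / ψ - (a + b * ω)) * ψ := by
      rw [hrdef]; field_simp
    have hlt : Complex.normSq r < Complex.normSq ψ := by
      rw [hrψ, Complex.normSq_mul]
      exact mul_lt_of_lt_one_left (Complex.normSq_pos.2 hψ0) hab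
    rw [hm, hψn] at hlt
    exact absurd (Nat.cast_le.2 hle) (not_le.2 (lt_of_mul_lt_mul_right hlt hc.le))
  · rintro ⟨a, b, rfl⟩
    exact int_mul_add_mul_mem hmul hψ a b

lemma int_eq_zero_of_eq_mul (him : ω.im ^ 2 = 3 / 4) {a b : ℤ} (h : (a : ℂ) = b * ω) :
    a = 0 ∧ b = 0 := by
  have h0 : ω.im ≠ 0 := by rintro h; norm_num [h] at him
  have hb : b = 0 := by
    have := congrArg Complex.im h
    simpa [h0] using this.symm
  subst hb
  exact ⟨by simpa using h, rfl⟩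

/-- If `ζ ≠ 0` and `ω * ζ` both lie in `ℤ ω₁ + ℤ ω₂`, then some nonzero integer multiple of
`ℤ ω₁ + ℤ ω₂` lies in `ζ ℤ[ω]`. -/
lemma exists_int_mul_eq (him : ω.im ^ 2 = 3 / 4) {ω₁ ω₂ ζ : ℂ} (hζ : ζ ≠ 0) {a b c d : ℤ}
    (h₁ : ζ = a * ω₁ + b * ω₂) (h₂ : ω * ζ = c * ω₁ + d * ω₂) :
    ∃ N : ℤ, N ≠ 0 ∧ ∀ m n : ℤ, ∃ p q : ℤ,
      (N : ℂ) * (m * ω₁ + n * ω₂) = (p + q * ω) * ζ := by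
  have hω₁ : ((a * d - b * c : ℤ) : ℂ) * ω₁ = (d - b * ω) * ζ := by
    push_cast; linear_combination b * h₂ - d * h₁
  have hω₂ : ((a * d - b * c : ℤ) : ℂ) * ω₂ = (a * ω - c) * ζ := by
    push_cast; linear_combination c * h₁ - a * h₂
  refine ⟨a * d - b * c, fun h => hζ ?_, fun m n => ⟨m * d - n * c, n * a - m * b, ?_⟩⟩
  · rw [h, Int.cast_zero, zero_mul, eq_comm, mul_eq_zero, or_iff_left hζ, sub_eq_zero] at hω₁ hω₂
    rw [h₁, (int_eq_zero_of_eq_mul him hω₁).2, (int_eq_zero_of_eq_mul him hω₂.symm).2]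
    simp
  · push_cast at hω₁ hω₂ ⊢
    linear_combination m * hω₁ + n * hω₂

end EisensteinLattice


/-- If `Λ ⊆ ℂ` is a lattice, `ω = e^{2πi/3}`, and
`M = {ζ : ζ·(ℤ + ℤ·ω) ⊆ Λ}` contains a nonzero element, then there is a nonzero
`ψ` with `M = ℤ·ψ + ℤ·(ω·ψ)`. -/
theorem hom_lattice_eisenstein_generated
    (ω : ℂ) (hω : ω = Complex.exp (2 * Real.pi * Complex.I / 3))
    (Λ : Set ℂ)
    (hΛ : ∃ ω₁ ω₂ : ℂ, LinearIndependent ℝ ![ω₁, ω₂] ∧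
      Λ = {z : ℂ | ∃ a b : ℤ, z = (a : ℂ) * ω₁ + (b : ℂ) * ω₂})
    (M : Set ℂ)
    (hM : M = {ζ : ℂ | ∀ u ∈ {z : ℂ | ∃ a b : ℤ, z = (a : ℂ) + (b : ℂ) * ω},
      ζ * u ∈ Λ})
    (hne : ∃ ζ ∈ M, ζ ≠ 0) :
    ∃ ψ : ℂ, ψ ≠ 0 ∧
      M = {z : ℂ | ∃ a b : ℤ, z = (a : ℂ) * ψ + (b : ℂ) * (ω * ψ)} := by
  obtain ⟨ω₁, ω₂, -, rfl⟩ := hΛ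
  obtain ⟨hre, him⟩ := EisensteinLattice.re_and_sq_im hω
  have hsq := EisensteinLattice.sq_eq hre him
  let L : AddSubgroup ℂ := AddSubgroup.closure {ω₁, ω₂}
  have hL : ∀ z, z ∈ L ↔ ∃ a b : ℤ, z = (a : ℂ) * ω₁ + (b : ℂ) * ω₂ := fun z => by
    simp only [L, AddSubgroup.mem_closure_pair, zsmul_eq_mul, eq_comm]
  let K : AddSubgroup ℂ := L ⊓ L.comap (AddMonoidHom.mulLeft ω)
  have hKL : ∀ z, z ∈ K ↔ z ∈ L ∧ ω * z ∈ L := fun z => Iff.rfl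
  have hMK : ∀ z, z ∈ M ↔ z ∈ K := by
    intro z
    simp only [hM, Set.mem_ofPred_eq, ← hL, hKL]
    constructor
    · intro h
      exact ⟨by simpa using h 1 ⟨1, 0, by simp⟩, by simpa [mul_comm] using h ω ⟨0, 1, by simp⟩⟩
    · rintro ⟨h₁, h₂⟩ u ⟨a, b, rfl⟩
      convert L.add_mem (L.zsmul_mem h₁ a) (L.zsmul_mem h₂ b) using 1
      simp only [zsmul_eq_mul]
      ring
  have hmul : ∀ z ∈ K, ω * z ∈ K := fun z hz => by
    refine ⟨hz.2, ?_⟩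
    have : ω * (ω * z) = -z - ω * z := by linear_combination z * hsq
    exact (this ▸ L.sub_mem (L.neg_mem hz.1) hz.2 : ω * (ω * z) ∈ L)
  obtain ⟨ζ, hζM, hζ⟩ := hne
  have hζK := (hMK ζ).1 hζM
  obtain ⟨a, b, h₁⟩ := (hL _).1 hζK.1
  obtain ⟨c, d, h₂⟩ := (hL _).1 hζK.2
  obtain ⟨N, hN, hNL⟩ := EisensteinLattice.exists_int_mul_eq him hζ h₁ h₂
  have hN' : (N : ℝ) ≠ 0 := Int.cast_ne_zero.2 hN
  have hnorm : ∀ z ∈ K, ∃ n : ℕ, Complex.normSq z = n * (Complex.normSq ζ / (N : ℝ) ^ 2) := by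
    intro z hz
    obtain ⟨m, n, rfl⟩ := (hL z).1 hz.1
    obtain ⟨p, q, hpq⟩ := hNL m n
    have hnn : 0 ≤ p ^ 2 - p * q + q ^ 2 := by nlinarith [sq_nonneg (p - q), sq_nonneg (p + q)]
    refine ⟨(p ^ 2 - p * q + q ^ 2).toNat, ?_⟩
    have hcast : (((p ^ 2 - p * q + q ^ 2).toNat : ℕ) : ℝ) = (p : ℝ) ^ 2 - p * q + q ^ 2 := by
      exact_mod_cast Int.toNat_of_nonneg hnn
    have h := congrArg Complex.normSq hpq
    have hform := EisensteinLattice.normSq_add_mul hre him p q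
    simp only [Complex.ofReal_intCast] at hform
    rw [Complex.normSq_mul, Complex.normSq_mul, hform, Complex.normSq_intCast] at h
    rw [hcast]
    field_simp
    linear_combination h
  obtain ⟨ψ, hψ, hgen⟩ := EisensteinLattice.exists_generator hre him hmul
    (div_pos (Complex.normSq_pos.2 hζ) (by positivity)) hnorm ⟨ζ, hζK, hζ⟩
  exact ⟨ψ, hψ, Set.ext fun z => (hMK z).trans (hgen z)⟩
end

section
/- Let K ⊆ ℂ be a subfield with [K : ℚ] = 2 and K ⊄ ℝ (an imaginary quadratic field), and let O_K be the integral closure of ℤ in K. Let Λ ⊆ ℂ be a lattice and set M := {ζ ∈ ℂ : ζ·O_K ⊆ Λ}. Suppose M contains a nonzero element. Then for every nonzero ζ₀ ∈ M: (i) ζ₀⁻¹·M ⊆ K; (ii) ζ₀⁻¹·M is an O_K-submodule of K; and (iii) there exists a positive integer N such that N·(ζ₀⁻¹·M) ⊆ O_K. In other words, M is homothetic in ℂ to a fractional ideal of O_K. -/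
/-- A nonreal subfield of `ℂ` that is finite over `ℚ` contains a nonreal algebraic integer. -/
theorem exists_mem_integralClosure_im_ne_zero (K : IntermediateField ℚ ℂ) [FiniteDimensional ℚ K]
    (hK : ¬ (K : Set ℂ) ⊆ Set.range Complex.ofReal) :
    ∃ τ : K, τ ∈ integralClosure ℤ K ∧ (τ : ℂ).im ≠ 0 := by
  obtain ⟨x, hxK, hx⟩ := Set.not_subset.mp hK
  have him : x.im ≠ 0 := fun h => hx ⟨x.re, Complex.ext (by simp) (by simp [h])⟩
  have halg : IsAlgebraic ℤ (⟨x, hxK⟩ : K) :=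
    (IsFractionRing.isAlgebraic_iff ℤ ℚ K).mpr (Algebra.IsAlgebraic.isAlgebraic _)
  obtain ⟨n, hn, hint⟩ := halg.exists_integral_multiple
  exact ⟨n • ⟨x, hxK⟩, hint, by simp [hn, him]⟩

/-- If `ζ` and `ζ * τ` lie in `ℤω₁ + ℤω₂`, with `ζ ≠ 0` and `τ` nonreal, then a nonzero integer
multiple of `ℤω₁ + ℤω₂` is contained in `ζ * (ℤ + ℤτ)`. -/
theorem exists_int_mul_mem_span_of_mul_mem {ω₁ ω₂ ζ τ : ℂ} (hζ : ζ ≠ 0) (hτ : τ.im ≠ 0)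
    (h₁ : ∃ a b : ℤ, ζ = (a : ℂ) * ω₁ + (b : ℂ) * ω₂)
    (h₂ : ∃ a b : ℤ, ζ * τ = (a : ℂ) * ω₁ + (b : ℂ) * ω₂) :
    ∃ D : ℤ, D ≠ 0 ∧ ∀ m n : ℤ, ∃ p q : ℤ,
      (D : ℂ) * ((m : ℂ) * ω₁ + (n : ℂ) * ω₂) = ζ * ((p : ℂ) + (q : ℂ) * τ) := by
  obtain ⟨a, b, hab⟩ := h₁
  obtain ⟨c, d, hcd⟩ := h₂
  refine ⟨a * d - b * c, fun hD => ?_, fun m n => ⟨m * d - n * c, n * a - m * b, ?_⟩⟩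
  · have hDC : (a : ℂ) * d - b * c = 0 := by exact_mod_cast hD
    have hb : (d : ℂ) = b * τ :=
      mul_left_cancel₀ hζ (by linear_combination (d : ℂ) * hab - b * hcd + ω₁ * hDC)
    have ha : (c : ℂ) = a * τ :=
      mul_left_cancel₀ hζ (by linear_combination (c : ℂ) * hab - a * hcd - ω₂ * hDC)
    have hb0 : b = 0 := by simpa [hτ] using congrArg Complex.im hb
    have ha0 : a = 0 := by simpa [hτ] using congrArg Complex.im ha
    exact hζ (by simp [hab, ha0, hb0])
  · push_cast
    linear_combination -((m : ℂ) * d - n * c) * hab - ((n : ℂ) * a - m * b) * hcd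

/-- `M = {ζ : ζ·O_K ⊆ Λ}` is homothetic to a fractional ideal of `O_K`:
for every nonzero `ζ₀ ∈ M`, (i) `ζ₀⁻¹·M ⊆ K`, (ii) `ζ₀⁻¹·M` is an `O_K`-submodule of
`K`, and (iii) some positive integer `N` satisfies `N·(ζ₀⁻¹·M) ⊆ O_K`. -/
theorem hom_lattice_fractional_ideal
    (K : IntermediateField ℚ ℂ)
    (hK2 : Module.finrank ℚ K = 2)
    (hKR : ¬ (K : Set ℂ) ⊆ Set.range Complex.ofReal)
    (Λ : Set ℂ)
    (hΛ : ∃ ω₁ ω₂ : ℂ, LinearIndependent ℝ ![ω₁, ω₂] ∧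
      Λ = {z : ℂ | ∃ a b : ℤ, z = (a : ℂ) * ω₁ + (b : ℂ) * ω₂})
    (M : Set ℂ)
    (hM : M = {ζ : ℂ | ∀ x : K, x ∈ integralClosure ℤ K → ζ * (x : ℂ) ∈ Λ})
    (hne : ∃ ζ ∈ M, ζ ≠ 0)
    (ζ₀ : ℂ) (hζ₀ : ζ₀ ∈ M) (hζ₀ne : ζ₀ ≠ 0) :
    -- (i) ζ₀⁻¹ · M ⊆ K
    (∀ z ∈ M, ζ₀⁻¹ * z ∈ (K : Set ℂ)) ∧
    -- (ii) ζ₀⁻¹ · M is an O_K-submodule of K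
    ((0 : ℂ) ∈ (fun z => ζ₀⁻¹ * z) '' M ∧
      (∀ x ∈ (fun z => ζ₀⁻¹ * z) '' M, ∀ y ∈ (fun z => ζ₀⁻¹ * z) '' M,
        x + y ∈ (fun z => ζ₀⁻¹ * z) '' M) ∧
      (∀ x ∈ (fun z => ζ₀⁻¹ * z) '' M, -x ∈ (fun z => ζ₀⁻¹ * z) '' M) ∧
      (∀ r : K, r ∈ integralClosure ℤ K →
        ∀ x ∈ (fun z => ζ₀⁻¹ * z) '' M, (r : ℂ) * x ∈ (fun z => ζ₀⁻¹ * z) '' M)) ∧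
    -- (iii) a common denominator N
    (∃ N : ℕ, 0 < N ∧ ∀ z ∈ M, ∃ w : K, w ∈ integralClosure ℤ K ∧
      (w : ℂ) = (N : ℂ) * (ζ₀⁻¹ * z)) := by
  have : FiniteDimensional ℚ K := Module.finite_of_finrank_pos (by omega)
  obtain ⟨τ, hτ, hτim⟩ := exists_mem_integralClosure_im_ne_zero K hKR
  obtain ⟨ω₁, ω₂, -, rfl⟩ := hΛ
  subst hM
  obtain ⟨D, hD, hspan⟩ := exists_int_mul_mem_span_of_mul_mem hζ₀ne hτim
    (by simpa using hζ₀ 1 (one_mem _)) (hζ₀ τ hτ)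
  have hden : ∀ z ∈ {ζ : ℂ | ∀ x : K, x ∈ integralClosure ℤ K →
      ζ * (x : ℂ) ∈ {z : ℂ | ∃ a b : ℤ, z = (a : ℂ) * ω₁ + (b : ℂ) * ω₂}},
      ∃ w : K, w ∈ integralClosure ℤ K ∧ (w : ℂ) = (D : ℂ) * (ζ₀⁻¹ * z) := by
    intro z hz
    obtain ⟨m, n, hmn⟩ := hz 1 (one_mem _)
    obtain ⟨p, q, hpq⟩ := hspan m n
    refine ⟨p + q * τ, add_mem (intCast_mem _ p) (mul_mem (intCast_mem _ q) hτ), ?_⟩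
    rw [← hmn] at hpq
    push_cast at hpq ⊢
    field_simp
    linear_combination -hpq
  refine ⟨fun z hz => ?_, ⟨?_, ?_, ?_, ?_⟩, D.natAbs, Int.natAbs_pos.mpr hD, fun z hz => ?_⟩
  · obtain ⟨w, -, hw⟩ := hden z hz
    have hDC : (D : ℂ) ≠ 0 := Int.cast_ne_zero.mpr hD
    rw [eq_comm, ← eq_inv_mul_iff_mul_eq₀ hDC] at hw
    rw [hw]
    exact mul_mem (inv_mem (intCast_mem K D)) w.2
  · exact ⟨0, fun x _ => ⟨0, 0, by simp⟩, mul_zero _⟩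
  · rintro _ ⟨y, hy, rfl⟩ _ ⟨z, hz, rfl⟩
    refine ⟨y + z, fun x hx => ?_, mul_add _ _ _⟩
    obtain ⟨a, b, hab⟩ := hy x hx
    obtain ⟨c, d, hcd⟩ := hz x hx
    exact ⟨a + c, b + d, by push_cast; linear_combination hab + hcd⟩
  · rintro _ ⟨y, hy, rfl⟩
    refine ⟨-y, fun x hx => ?_, mul_neg _ _⟩
    obtain ⟨a, b, hab⟩ := hy x hx
    exact ⟨-a, -b, by push_cast; linear_combination -hab⟩
  · rintro r hr _ ⟨y, hy, rfl⟩
    refine ⟨r * y, fun x hx => ?_, mul_left_comm _ _ _⟩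
    obtain ⟨a, b, hab⟩ := hy (r * x) (mul_mem hr hx)
    exact ⟨a, b, by push_cast at hab; linear_combination hab⟩
  · obtain ⟨w, hw, hwz⟩ := hden z hz
    rcases Int.natAbs_eq D with h | h
    · exact ⟨w, hw, by rw [hwz, h]; simp⟩
    · exact ⟨-w, neg_mem hw, by push_cast; rw [hwz, h]; simp⟩
end

section
/- Let Λ = ℤ + ℤ·(2i) ⊆ ℂ. Then {ζ ∈ ℂ : ζ·(ℤ + ℤ·i) ⊆ Λ} = ℤ·2 + ℤ·(2i) = 2·ℤ[i]. In particular, writing ψ for the element 2, this set equals ⟨ψ, i·ψ⟩ as a ℤ-module. -/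
/-- for `Λ = ℤ + ℤ·2i`,
`{ζ : ζ·(ℤ + ℤ·i) ⊆ Λ} = ℤ·2 + ℤ·(2i) = 2·ℤ[i]`. -/
theorem hom_lattice_example
    (Λ : Set ℂ) (hΛ : Λ = {z : ℂ | ∃ a b : ℤ, z = (a : ℂ) + (b : ℂ) * (2 * Complex.I)})
    (L : Set ℂ) (hL : L = {z : ℂ | ∃ a b : ℤ, z = (a : ℂ) + (b : ℂ) * Complex.I}) :
    {ζ : ℂ | ∀ u ∈ L, ζ * u ∈ Λ} =
      {z : ℂ | ∃ a b : ℤ, z = (a : ℂ) * 2 + (b : ℂ) * (2 * Complex.I)} := by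
  subst hΛ hL
  ext ζ
  constructor
  · intro h
    obtain ⟨a, b, hab⟩ := h 1 ⟨1, 0, by simp⟩
    obtain ⟨c, d, hcd⟩ := h Complex.I ⟨0, 1, by simp⟩
    rw [mul_one] at hab
    refine ⟨d, b, ?_⟩
    have had : (a : ℝ) = d * 2 := by
      simpa [hab] using congrArg Complex.im hcd
    have had' : (a : ℂ) = d * 2 := by exact_mod_cast had
    rw [hab, had']
  · rintro ⟨a, b, rfl⟩ _ ⟨c, d, rfl⟩
    refine ⟨2 * (a * c - b * d), a * d + b * c, ?_⟩
    push_cast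
    linear_combination (2 * b * d : ℂ) * Complex.I_sq
end
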